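/- arXiv:1808.06157 — 2 statements merged into one kernel-verified Lean document; each statement's English description precedes it below -/
import Mathlib

section
/- Let n ≥ 3 and q ≥ 2 be integers, let ε be a real number with 0 < ε ≤ 1/80, and let w be an integer with 1 ≤ w ≤ min{1/(100ε), ε·n}. Then the number of (n−1)×(n−1) matrices y over ℤ/qℤ with N(y) ≤ (w − 40wε)·n² is at most q^{16w}·n^{2(w−1)}. -/
/-- `Σ_{h=i}^{j} u_h` (1-based indices) for a vector `u`. -/
def isum {m q : ℕ} (u : Fin m → ZMod q) (i j : ℕ) : ZMod q :=
  ∑ a ∈ Finset.univ.filter (fun a : Fin m => i ≤ (a : ℕ) + 1 ∧ (a : ℕ) + 1 ≤ j), u a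

/-- `S(u)`: the number of nonzero intervals of `u` (1-based intervals `[i,j] ⊆ [1,m]`). -/
def nzIntervals {m q : ℕ} (u : Fin m → ZMod q) : ℕ :=
  ((Finset.Icc 1 m ×ˢ Finset.Icc 1 m).filter
    (fun p => p.1 ≤ p.2 ∧ isum u p.1 p.2 ≠ 0)).card

/-- The sum of the entries of `y` over the box `[i,j] × [k,l]` (1-based indices). -/
def bsum {m q : ℕ} (y : Matrix (Fin m) (Fin m) (ZMod q)) (i j k l : ℕ) : ZMod q :=
  ∑ a ∈ Finset.univ.filter (fun a : Fin m => i ≤ (a : ℕ) + 1 ∧ (a : ℕ) + 1 ≤ j),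
    ∑ c ∈ Finset.univ.filter (fun c : Fin m => k ≤ (c : ℕ) + 1 ∧ (c : ℕ) + 1 ≤ l), y a c

/-- `N(y)`: the number of nonzero boxes of `y`. -/
def Nboxes {m q : ℕ} (y : Matrix (Fin m) (Fin m) (ZMod q)) : ℕ :=
  (((Finset.Icc 1 m ×ˢ Finset.Icc 1 m) ×ˢ (Finset.Icc 1 m ×ˢ Finset.Icc 1 m)).filter
    (fun p => p.1.1 ≤ p.1.2 ∧ p.2.1 ≤ p.2.2 ∧ bsum y p.1.1 p.1.2 p.2.1 p.2.2 ≠ 0)).card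

lemma isum_succ_left {m q : ℕ} (u : Fin m → ZMod q) {i j : ℕ} (h : i ≤ j) :
    isum u (i + 1) j = isum u 1 j - isum u 1 i := by
  unfold isum
  rw [eq_sub_iff_add_eq, ← Finset.sum_union]
  · congr 1
    ext a
    simp only [Finset.mem_union, Finset.mem_filter, Finset.mem_univ, true_and]
    omega
  · rw [Finset.disjoint_filter]
    intro a _ h1 h2
    omega

lemma bsum_eq_isum_isum {m q : ℕ} (y : Matrix (Fin m) (Fin m) (ZMod q)) (i j k l : ℕ) :
    bsum y i j k l = isum (fun a => isum (y a) k l) i j := rfl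

/-- The array of sums of `y` over its top-left boxes. -/
def cumSum {m q : ℕ} (y : Matrix (Fin m) (Fin m) (ZMod q)) (i k : Fin (m + 1)) : ZMod q :=
  bsum y 1 i 1 k

/-- The mixed difference of an array over the rows `i`, `j` and the columns `k`, `l`. -/
def mixedDiff {α β G : Type*} [AddCommGroup G] (g : α → β → G) (i j : α) (k l : β) : G :=
  g j l - g i l - g j k + g i k

lemma bsum_eq_mixedDiff {m q : ℕ} (y : Matrix (Fin m) (Fin m) (ZMod q)) {i j k l : Fin (m + 1)}
    (hij : i ≤ j) (hkl : k ≤ l) :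
    bsum y (i + 1) j (k + 1) l = mixedDiff (cumSum y) i j k l := by
  have hsub (u v : Fin m → ZMod q) (s t : ℕ) :
      isum (fun a => u a - v a) s t = isum u s t - isum v s t := by
    simp [isum, Finset.sum_sub_distrib]
  simp only [mixedDiff, cumSum, bsum_eq_isum_isum]
  rw [isum_succ_left _ (Fin.le_def.mp hij)]
  simp only [isum_succ_left _ (Fin.le_def.mp hkl), hsub]
  abel

lemma mixedDiff_cumSum_succ {m q : ℕ} (y : Matrix (Fin m) (Fin m) (ZMod q)) (a c : Fin m) :
    mixedDiff (cumSum y) a.castSucc a.succ c.castSucc c.succ = y a c := by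
  rw [← bsum_eq_mixedDiff y (Fin.castSucc_lt_succ).le (Fin.castSucc_lt_succ).le]
  have h (b : Fin m) : Finset.univ.filter
      (fun d : Fin m => (b : ℕ) + 1 ≤ (d : ℕ) + 1 ∧ (d : ℕ) + 1 ≤ (b : ℕ) + 1) = {b} := by
    ext d
    simp only [Finset.mem_filter, Finset.mem_univ, true_and, Finset.mem_singleton, Fin.ext_iff]
    omega
  simp only [bsum, Fin.val_castSucc, Fin.val_succ, h, Finset.sum_singleton]

/-- The box spanned by the corners `x.1` and `x.2` of the array of cumulative sums. -/
def cornerBox {m : ℕ} (x : (Fin (m + 1) × Fin (m + 1)) × (Fin (m + 1) × Fin (m + 1))) :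
    (ℕ × ℕ) × (ℕ × ℕ) :=
  ((min (x.1.1 : ℕ) x.2.1 + 1, max (x.1.1 : ℕ) x.2.1),
    (min (x.1.2 : ℕ) x.2.2 + 1, max (x.1.2 : ℕ) x.2.2))

/-- The set of nonzero boxes of `y`. -/
def nonzeroBoxes {m q : ℕ} (y : Matrix (Fin m) (Fin m) (ZMod q)) : Finset ((ℕ × ℕ) × (ℕ × ℕ)) :=
  ((Finset.Icc 1 m ×ˢ Finset.Icc 1 m) ×ˢ (Finset.Icc 1 m ×ˢ Finset.Icc 1 m)).filter
    (fun p => p.1.1 ≤ p.1.2 ∧ p.2.1 ≤ p.2.2 ∧ bsum y p.1.1 p.1.2 p.2.1 p.2.2 ≠ 0)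

lemma card_nonzeroBoxes {m q : ℕ} (y : Matrix (Fin m) (Fin m) (ZMod q)) :
    (nonzeroBoxes y).card = Nboxes y := rfl

lemma mem_nonzeroBoxes_of_lt {m q : ℕ} (y : Matrix (Fin m) (Fin m) (ZMod q))
    {i j k l : Fin (m + 1)} (hij : i < j) (hkl : k < l)
    (h : mixedDiff (cumSum y) i j k l ≠ 0) :
    (((i : ℕ) + 1, (j : ℕ)), ((k : ℕ) + 1, (l : ℕ))) ∈ nonzeroBoxes y := by
  rw [← bsum_eq_mixedDiff y hij.le hkl.le] at h
  simp only [nonzeroBoxes, Finset.mem_filter, Finset.mem_product, Finset.mem_Icc]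
  rw [Fin.lt_def] at hij hkl
  refine ⟨?_, ?_, ?_, h⟩ <;> omega

lemma cornerBox_mem_nonzeroBoxes {m q : ℕ} (y : Matrix (Fin m) (Fin m) (ZMod q))
    {x : (Fin (m + 1) × Fin (m + 1)) × (Fin (m + 1) × Fin (m + 1))}
    (h : mixedDiff (cumSum y) x.1.1 x.2.1 x.1.2 x.2.2 ≠ 0) :
    cornerBox x ∈ nonzeroBoxes y := by
  obtain ⟨⟨i, k⟩, ⟨j, l⟩⟩ := x
  have swap_rows : mixedDiff (cumSum y) j i k l = - mixedDiff (cumSum y) i j k l := by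
    simp only [mixedDiff]; abel
  have swap_cols : mixedDiff (cumSum y) i j l k = - mixedDiff (cumSum y) i j k l := by
    simp only [mixedDiff]; abel
  have swap_both : mixedDiff (cumSum y) j i l k = mixedDiff (cumSum y) i j k l := by
    simp only [mixedDiff]; abel
  dsimp only at h
  rcases lt_trichotomy i j with hij | rfl | hij
  · have hij' := Fin.lt_def.mp hij
    rcases lt_trichotomy k l with hkl | rfl | hkl
    · simpa [cornerBox, hij.le, hkl.le] using mem_nonzeroBoxes_of_lt y hij hkl h
    · simp [mixedDiff] at h
    · simpa [cornerBox, hij.le, hkl.le] using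
        mem_nonzeroBoxes_of_lt y hij hkl (by rw [swap_cols]; simpa using h)
  · simp [mixedDiff] at h
  · rcases lt_trichotomy k l with hkl | rfl | hkl
    · simpa [cornerBox, hij.le, hkl.le] using
        mem_nonzeroBoxes_of_lt y hij hkl (by rw [swap_rows]; simpa using h)
    · simp [mixedDiff] at h
    · simpa [cornerBox, hij.le, hkl.le] using
        mem_nonzeroBoxes_of_lt y hij hkl (by rw [swap_both]; exact h)

/-- The array `f` normalised to vanish on the row and the column of `x`. -/
def normalizeAt {α β G : Type*} [AddCommGroup G] (f : α → β → G) (x z : α × β) : G :=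
  mixedDiff f x.1 z.1 x.2 z.2

lemma mixedDiff_normalizeAt {α β G : Type*} [AddCommGroup G] (f : α → β → G) (x : α × β)
    (i j : α) (k l : β) :
    mixedDiff (fun a b => normalizeAt f x (a, b)) i j k l = mixedDiff f i j k l := by
  simp only [mixedDiff, normalizeAt]
  abel

/-- The support of the cumulative sums of `y` normalised at `x`. -/
def normalizedSupport {m q : ℕ} (y : Matrix (Fin m) (Fin m) (ZMod q))
    (x : Fin (m + 1) × Fin (m + 1)) : Finset (Fin (m + 1) × Fin (m + 1)) :=
  Finset.univ.filter (fun z => normalizeAt (cumSum y) x z ≠ 0)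

lemma exists_card_normalizedSupport_le {m q w : ℕ} (y : Matrix (Fin m) (Fin m) (ZMod q))
    (h : Nboxes y ≤ w * (m + 1) ^ 2) : ∃ x, (normalizedSupport y x).card ≤ 4 * w := by
  classical
  let Q : Finset ((Fin (m + 1) × Fin (m + 1)) × (Fin (m + 1) × Fin (m + 1))) :=
    Finset.univ.filter (fun x => normalizeAt (cumSum y) x.1 x.2 ≠ 0)
  have hQ : Q.card ≤ 4 * (nonzeroBoxes y).card := by
    refine Finset.card_le_mul_card_image_of_maps_to (f := cornerBox) ?_ 4 ?_
    · intro x hx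
      exact cornerBox_mem_nonzeroBoxes y (Finset.mem_filter.mp hx).2
    · rintro ⟨⟨i, j⟩, ⟨k, l⟩⟩ -
      let P : Finset ((ℕ × ℕ) × (ℕ × ℕ)) :=
        {(i - 1, j), (j, i - 1)} ×ˢ {(k - 1, l), (l, k - 1)}
      calc _ ≤ P.card := by
            refine Finset.card_le_card_of_injOn
              (fun x => (((x.1.1 : ℕ), (x.2.1 : ℕ)), ((x.1.2 : ℕ), (x.2.2 : ℕ)))) ?_ ?_
            · rintro ⟨⟨a, c⟩, ⟨b, d⟩⟩ hx
              have hx := (Finset.mem_filter.mp hx).2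
              simp only [cornerBox, Prod.mk.injEq] at hx
              simp only [P, Finset.coe_product, Set.mem_prod, Finset.mem_coe, Finset.mem_insert,
                Finset.mem_singleton, Prod.mk.injEq]
              omega
            · rintro ⟨⟨a, c⟩, ⟨b, d⟩⟩ - ⟨⟨a', c'⟩, ⟨b', d'⟩⟩ - hx
              simp only [Prod.mk.injEq, Fin.ext_iff] at hx ⊢
              tauto
        _ ≤ 2 * 2 := by
            rw [Finset.card_product]
            exact Nat.mul_le_mul Finset.card_le_two Finset.card_le_two
  obtain ⟨x, -, hx⟩ := Finset.exists_card_fiber_le_of_card_le_mul (s := Q) (t := Finset.univ)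
    (f := Prod.fst) (n := 4 * w) Finset.univ_nonempty (by
      rw [card_nonzeroBoxes] at hQ
      simp only [Finset.card_univ, Fintype.card_prod, Fintype.card_fin]
      nlinarith)
  refine ⟨x, le_trans ?_ hx⟩
  refine Finset.card_le_card_of_injOn (fun z => (x, z)) ?_ ?_
  · intro z hz
    simpa [Q, normalizedSupport] using hz
  · intro z _ z' _ hzz
    exact (Prod.mk.inj hzz).2

lemma card_normalizedSupport_mul_le {m q : ℕ} (y : Matrix (Fin m) (Fin m) (ZMod q))
    (x : Fin (m + 1) × Fin (m + 1)) :
    (normalizedSupport y x).card * (m + 1 - (normalizedSupport y x).card) ^ 2 ≤ Nboxes y := by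
  classical
  set s := normalizedSupport y x with hs
  have mem_s (a c : Fin (m + 1)) : (a, c) ∈ s ↔ normalizeAt (cumSum y) x (a, c) ≠ 0 := by
    simp [hs, normalizedSupport]
  have hcompl (t : Finset (Fin (m + 1))) (ht : t.card ≤ s.card) : m + 1 - s.card ≤ tᶜ.card := by
    rw [Finset.card_compl, Fintype.card_fin]
    omega
  have hR := hcompl (s.image Prod.fst) Finset.card_image_le
  have hC := hcompl (s.image Prod.snd) Finset.card_image_le
  calc s.card * (m + 1 - s.card) ^ 2
      ≤ (s ×ˢ ((s.image Prod.fst)ᶜ ×ˢ (s.image Prod.snd)ᶜ)).card := by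
        rw [Finset.card_product, Finset.card_product, sq]
        gcongr
    _ ≤ (nonzeroBoxes y).card := by
        refine Finset.card_le_card_of_injOn cornerBox ?_ ?_
        · rintro ⟨⟨i, k⟩, ⟨j, l⟩⟩ hx
          simp only [Finset.coe_product, Set.mem_prod, Finset.mem_coe, Finset.mem_compl,
            Finset.mem_image, Prod.exists, exists_and_right, exists_eq_right, not_exists] at hx
          obtain ⟨hik, hj, hl⟩ := hx
          have h1 := hj k
          have h2 := hj l
          have h3 := hl i
          rw [mem_s, not_not] at h1 h2 h3
          rw [mem_s] at hik
          refine cornerBox_mem_nonzeroBoxes y ?_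
          rw [← mixedDiff_normalizeAt _ x]
          simpa [mixedDiff, h1, h2, h3] using hik
        · rintro ⟨⟨i, k⟩, ⟨j, l⟩⟩ hx ⟨⟨i', k'⟩, ⟨j', l'⟩⟩ hx' h
          simp only [Finset.coe_product, Set.mem_prod, Finset.mem_coe, Finset.mem_compl] at hx hx'
          obtain ⟨hik, hj, hl⟩ := hx
          obtain ⟨hik', hj', hl'⟩ := hx'
          have hi := Finset.mem_image_of_mem Prod.fst hik
          have hk := Finset.mem_image_of_mem Prod.snd hik
          have hi' := Finset.mem_image_of_mem Prod.fst hik'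
          have hk' := Finset.mem_image_of_mem Prod.snd hik'
          have n1 : (i : ℕ) ≠ j' := fun e => hj' (Fin.ext e ▸ hi)
          have n2 : (i' : ℕ) ≠ j := fun e => hj (Fin.ext e ▸ hi')
          have n3 : (k : ℕ) ≠ l' := fun e => hl' (Fin.ext e ▸ hk)
          have n4 : (k' : ℕ) ≠ l := fun e => hl (Fin.ext e ▸ hk')
          simp only [cornerBox, Prod.mk.injEq, Fin.ext_iff] at h ⊢
          omega
    _ = Nboxes y := rfl

open Classical in
/-- The function taking the value `p.2 t` at `p.1 t`, and `0` outside the range of `p.1`. -/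
noncomputable def sparseFun {ι X G : Type*} [Zero G] (p : (ι → X) × (ι → G)) (x : X) : G :=
  if h : ∃ t, p.1 t = x then p.2 h.choose else 0

lemma exists_sparseFun_eq {W : ℕ} {X G : Type*} [Inhabited X] [Zero G] (g : X → G)
    (s : Finset X) (hs : ∀ x, g x ≠ 0 → x ∈ s) (hW : s.card ≤ W) :
    ∃ p : (Fin W → X) × (Fin W → G), sparseFun p = g := by
  obtain ⟨e⟩ := Function.Embedding.nonempty_of_card_le (α := s) (β := Fin W) (by simpa using hW)
  let pos : Fin W → X := Function.extend e Subtype.val (fun _ => default)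
  refine ⟨(pos, g ∘ pos), ?_⟩
  funext x
  unfold sparseFun
  split_ifs with h
  · exact congrArg g h.choose_spec
  · by_contra hx
    exact h ⟨e ⟨x, hs x (Ne.symm hx)⟩,
      e.injective.extend_apply Subtype.val (fun _ => default) ⟨x, hs x (Ne.symm hx)⟩⟩

lemma ncard_le_of_exists_sparse {m q W : ℕ} [NeZero q]
    (S : Set (Matrix (Fin m) (Fin m) (ZMod q)))
    (hS : ∀ y ∈ S, ∃ x, (normalizedSupport y x).card ≤ W) :
    S.ncard ≤ (m + 1) ^ (2 * W) * q ^ W := by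
  let X := Fin (m + 1) × Fin (m + 1)
  let φ : (Fin W → X) × (Fin W → ZMod q) → Matrix (Fin m) (Fin m) (ZMod q) := fun p a c =>
    mixedDiff (fun i k => sparseFun p (i, k)) a.castSucc a.succ c.castSucc c.succ
  have hsub : S ⊆ φ '' Set.univ := by
    intro y hy
    obtain ⟨x, hx⟩ := hS y hy
    obtain ⟨p, hp⟩ := exists_sparseFun_eq (normalizeAt (cumSum y) x) (normalizedSupport y x)
      (fun z hz => by simpa [normalizedSupport] using hz) hx
    refine ⟨p, trivial, ?_⟩
    ext a c
    simp only [φ, hp, mixedDiff_normalizeAt, mixedDiff_cumSum_succ]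
  calc S.ncard ≤ (φ '' Set.univ).ncard := Set.ncard_le_ncard hsub (Set.toFinite _)
    _ ≤ (Set.univ : Set ((Fin W → X) × (Fin W → ZMod q))).ncard := Set.ncard_image_le
    _ = (m + 1) ^ (2 * W) * q ^ W := by
      simp [X, Set.ncard_univ, ZMod.card, pow_mul, sq]

lemma lt_of_card_mul_sq_le {n w d N : ℕ} {ε : ℝ} (hε0 : 0 < ε) (hε1 : ε ≤ 1 / 80)
    (hn : 0 < n) (hw1 : 1 ≤ w) (hw : (w : ℝ) ≤ ε * n) (hd : d ≤ 4 * w)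
    (hN : d * (n - d) ^ 2 ≤ N) (hNw : (N : ℝ) ≤ ((w : ℝ) - 40 * w * ε) * (n : ℝ) ^ 2) :
    d < w := by
  by_contra! hwd
  have hn' : (0 : ℝ) < n := by exact_mod_cast hn
  have hw' : (0 : ℝ) < w := by exact_mod_cast hw1
  have hwd' : (w : ℝ) ≤ d := by exact_mod_cast hwd
  have hd' : (d : ℝ) ≤ 4 * w := by exact_mod_cast hd
  have hdn : (d : ℝ) ≤ 4 * ε * n := by linarith
  have hdn' : d ≤ n := by
    have : (d : ℝ) ≤ n := by nlinarith
    exact_mod_cast this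
  have hN' : (d : ℝ) * ((n : ℝ) - d) ^ 2 ≤ N := by
    rw [← Nat.cast_sub hdn']
    exact_mod_cast hN
  have hsq : ((1 - 4 * ε) * n) ^ 2 ≤ ((n : ℝ) - d) ^ 2 := by
    apply pow_le_pow_left₀
    · apply mul_nonneg _ hn'.le
      linarith
    · linarith
  have hlow : (w : ℝ) * ((1 - 4 * ε) * n) ^ 2 ≤ (d : ℝ) * ((n : ℝ) - d) ^ 2 := by gcongr
  have hpos : 0 < (w : ℝ) * (n : ℝ) ^ 2 * (32 * ε + 16 * ε ^ 2) := by positivity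
  nlinarith

theorem stmt16 (n q : ℕ) (hn : 3 ≤ n) (hq : 2 ≤ q)
    (ε : ℝ) (hε0 : 0 < ε) (hε1 : ε ≤ 1 / 80)
    (w : ℕ) (hw1 : 1 ≤ w) (hw2 : (w : ℝ) ≤ min (1 / (100 * ε)) (ε * n)) :
    (Set.ncard {y : Matrix (Fin (n - 1)) (Fin (n - 1)) (ZMod q) |
        (Nboxes y : ℝ) ≤ ((w : ℝ) - 40 * w * ε) * (n : ℝ) ^ 2} : ℝ)
      ≤ (q : ℝ) ^ (16 * (w : ℝ)) * (n : ℝ) ^ (2 * ((w : ℝ) - 1)) := by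
  obtain ⟨m, rfl⟩ : ∃ m, n = m + 1 := ⟨n - 1, by omega⟩
  obtain ⟨W, rfl⟩ : ∃ W, w = W + 1 := ⟨w - 1, by omega⟩
  have : NeZero q := ⟨by omega⟩
  have hw : ((W + 1 : ℕ) : ℝ) ≤ ε * (m + 1 : ℕ) := hw2.trans (min_le_right _ _)
  have hcount := ncard_le_of_exists_sparse (W := W)
    {y : Matrix (Fin m) (Fin m) (ZMod q) | (Nboxes y : ℝ) ≤
      (((W + 1 : ℕ) : ℝ) - 40 * (W + 1 : ℕ) * ε) * ((m + 1 : ℕ) : ℝ) ^ 2} (by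
    intro y hy
    rw [Set.mem_ofPred_eq] at hy
    obtain ⟨x, hx⟩ := exists_card_normalizedSupport_le (w := W + 1) y (by
      have : (Nboxes y : ℝ) ≤ ((W + 1 : ℕ) : ℝ) * ((m + 1 : ℕ) : ℝ) ^ 2 := by
        refine hy.trans (mul_le_mul_of_nonneg_right ?_ (by positivity))
        have : 0 ≤ 40 * ((W + 1 : ℕ) : ℝ) * ε := by positivity
        linarith
      exact_mod_cast this)
    exact ⟨x, Nat.lt_succ_iff.mp (lt_of_card_mul_sq_le hε0 hε1 m.succ_pos hw1 hw hx
      (card_normalizedSupport_mul_le y x) hy)⟩)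
  have hexp_n : 2 * (((W + 1 : ℕ) : ℝ) - 1) = ((2 * W : ℕ) : ℝ) := by push_cast; ring
  have hexp_q : 16 * ((W + 1 : ℕ) : ℝ) = ((16 * (W + 1) : ℕ) : ℝ) := by push_cast; ring
  rw [hexp_n, hexp_q, Real.rpow_natCast, Real.rpow_natCast, mul_comm ((q : ℝ) ^ _)]
  have hq_pow : q ^ W ≤ q ^ (16 * (W + 1)) := Nat.pow_le_pow_right (by omega) (by omega)
  exact_mod_cast hcount.trans (Nat.mul_le_mul_left _ hq_pow)
end

section
/- Let n ≥ 3 and q ≥ 2 be integers, let ε be a real number with 1/√(log n) ≤ ε ≤ 1/80, and let w be an integer with w ≥ ε·n. Then the number of (n−1)×(n−1) matrices y over ℤ/qℤ with N(y) ≤ (w + 1/2)·n² is at most n^{2w + C₁·ε·w}, where C₁ = 200·(log q)/(ε·√(log n)) + 80. -/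
/-- The number of ordered pairs of indices at which `h` takes different values. -/
def pairDiff {k : ℕ} {α : Type*} [DecidableEq α] (h : Fin k → α) : ℕ :=
  ∑ c, (Finset.univ.filter fun d => h d ≠ h c).card

/-- The value `0` is taken by `h` at least as often as any other value. -/
def IsZeroMode {k : ℕ} {α : Type*} [DecidableEq α] [Zero α] (h : Fin k → α) : Prop :=
  ∀ v, (Finset.univ.filter fun d => h d = v).card ≤ (Finset.univ.filter fun d => h d = 0).card

/-- The support of `h` as a finset. -/
def suppFinset {k : ℕ} {α : Type*} [DecidableEq α] [Zero α] (h : Fin k → α) : Finset (Fin k) :=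
  Finset.univ.filter fun d => h d ≠ 0

theorem card_zeros_add_card_suppFinset {k : ℕ} {α : Type*} [DecidableEq α] [Zero α]
    (h : Fin k → α) :
    (Finset.univ.filter fun d => h d = 0).card + (suppFinset h).card = k := by
  simpa [suppFinset] using
    Finset.card_filter_add_card_filter_not (s := (Finset.univ : Finset (Fin k))) (fun d => h d = 0)

theorem IsZeroMode.mul_card_suppFinset_le {k : ℕ} {α : Type*} [DecidableEq α] [Zero α]
    {h : Fin k → α} (hh : IsZeroMode h) : k * (suppFinset h).card ≤ pairDiff h := by
  have key : ∀ c ∈ (Finset.univ : Finset (Fin k)),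
      (suppFinset h).card ≤ (Finset.univ.filter fun d => h d ≠ h c).card := by
    intro c _
    have h1 := Finset.card_filter_add_card_filter_not
      (s := (Finset.univ : Finset (Fin k))) (fun d => h d = h c)
    have h2 := card_zeros_add_card_suppFinset h
    have h3 := hh (h c)
    simp only [Finset.card_univ, Fintype.card_fin] at h1
    simp only [ne_eq]
    omega
  simpa [pairDiff] using Finset.card_nsmul_le_sum _ _ _ key

theorem two_mul_card_suppFinset_mul_le {k : ℕ} {α : Type*} [DecidableEq α] [Zero α]
    (h : Fin k → α) :
    2 * ((suppFinset h).card * (Finset.univ.filter fun d => h d = 0).card) ≤ pairDiff h := by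
  have h1 : (Finset.univ.filter fun d => h d = 0).card * (suppFinset h).card ≤
      ∑ c ∈ Finset.univ.filter (fun d => h d = 0),
        (Finset.univ.filter fun d => h d ≠ h c).card := by
    rw [← smul_eq_mul]
    refine Finset.card_nsmul_le_sum _ _ _ fun c hc => ?_
    rw [(Finset.mem_filter.1 hc).2]
    rfl
  have h2 : (suppFinset h).card * (Finset.univ.filter fun d => h d = 0).card ≤
      ∑ c ∈ Finset.univ.filter (fun d => ¬ h d = 0),
        (Finset.univ.filter fun d => h d ≠ h c).card := by
    rw [← smul_eq_mul]
    refine Finset.card_nsmul_le_sum _ _ _ fun c hc => Finset.card_le_card fun d hd => ?_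
    simp only [Finset.mem_filter, Finset.mem_univ, true_and] at hd ⊢
    rw [hd]
    exact fun h0 => (Finset.mem_filter.1 hc).2 h0.symm
  have h3 := Finset.sum_filter_add_sum_filter_not (Finset.univ : Finset (Fin k))
    (fun d => h d = 0) (fun c => (Finset.univ.filter fun d => h d ≠ h c).card)
  unfold pairDiff
  rw [← h3]
  linarith

/-- The weight of a row: sparse rows get a large weight, and all rows a small positive one. -/
noncomputable def rowWeight {k q : ℕ} (h : Fin k → ZMod q) : ℝ :=
  (∏ c, if h c = 0 then (1 : ℝ) else ((k : ℝ) * q)⁻¹) + ((q : ℝ) ^ k)⁻¹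

theorem sum_rowWeight_le {k q : ℕ} [NeZero q] (hk : 0 < k) :
    ∑ h : Fin k → ZMod q, rowWeight h ≤ 4 := by
  have hq : (0 : ℝ) < q := by exact_mod_cast Nat.pos_of_ne_zero (NeZero.ne q)
  have hk' : (0 : ℝ) < k := by exact_mod_cast hk
  unfold rowWeight
  rw [Finset.sum_add_distrib]
  have h1 : ∑ h : Fin k → ZMod q, ∏ c, (if h c = 0 then (1 : ℝ) else ((k : ℝ) * q)⁻¹) ≤ 3 := by
    rw [← Fintype.sum_pow (fun v : ZMod q => if v = 0 then (1 : ℝ) else ((k : ℝ) * q)⁻¹) k]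
    have h2 : ∑ v : ZMod q, (if v = 0 then (1 : ℝ) else ((k : ℝ) * q)⁻¹) ≤ 1 + 1 / k := by
      calc ∑ v : ZMod q, (if v = 0 then (1 : ℝ) else ((k : ℝ) * q)⁻¹)
          ≤ ∑ v : ZMod q, ((if v = 0 then (1 : ℝ) else 0) + ((k : ℝ) * q)⁻¹) := by
            refine Finset.sum_le_sum fun v _ => ?_
            have : 0 ≤ ((k : ℝ) * q)⁻¹ := by positivity
            split_ifs <;> linarith
        _ = 1 + 1 / k := by
            rw [Finset.sum_add_distrib]
            simp only [Finset.sum_ite_eq', Finset.mem_univ, if_true, Finset.sum_const,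
              Finset.card_univ, ZMod.card, nsmul_eq_mul]
            field_simp
    have h0 : 0 ≤ ∑ v : ZMod q, (if v = 0 then (1 : ℝ) else ((k : ℝ) * q)⁻¹) := by
      refine Finset.sum_nonneg fun v _ => ?_
      split_ifs <;> positivity
    calc _ ≤ (1 + 1 / (k : ℝ)) ^ k := pow_le_pow_left₀ h0 h2 k
      _ ≤ Real.exp (1 / k) ^ k := by
          refine pow_le_pow_left₀ (by positivity) ?_ k
          linarith [Real.add_one_le_exp (1 / (k : ℝ))]
      _ = Real.exp 1 := by
          rw [← Real.exp_nat_mul]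
          congr 1
          field_simp
      _ ≤ 3 := by linarith [Real.exp_one_lt_d9]
  have h2 : ∑ _h : Fin k → ZMod q, ((q : ℝ) ^ k)⁻¹ = 1 := by
    simp only [Finset.sum_const, Finset.card_univ, Fintype.card_fun, ZMod.card, Fintype.card_fin,
      nsmul_eq_mul, Nat.cast_pow]
    field_simp
  linarith

theorem IsZeroMode.exp_neg_le_rowWeight {k q : ℕ} (hk : 0 < k) (hq : 0 < q)
    {h : Fin k → ZMod q} (hh : IsZeroMode h) {ε K : ℝ} (hε0 : 0 < ε) (hε1 : ε < 1)
    (hK : 2 ≤ ε * K) :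
    Real.exp (-((Real.log k + K * Real.log q) / (2 * (1 - ε) * k) * pairDiff h)) ≤
      rowWeight h := by
  have hq' : (1 : ℝ) ≤ q := by exact_mod_cast hq
  have hk' : (1 : ℝ) ≤ k := by exact_mod_cast hk
  have hlk : 0 ≤ Real.log k := Real.log_nonneg hk'
  have hlq : 0 ≤ Real.log q := Real.log_nonneg hq'
  have hK1 : 1 ≤ K := by nlinarith
  have hP : ∏ c, (if h c = 0 then (1 : ℝ) else ((k : ℝ) * q)⁻¹) =
      Real.exp (-((Real.log k + Real.log q) * (suppFinset h).card)) := by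
    rw [Finset.prod_ite, Finset.prod_const_one, one_mul, Finset.prod_const,
      ← Real.log_mul (by positivity) (by positivity), mul_comm (Real.log _), ← mul_neg,
      Real.exp_nat_mul, Real.exp_neg, Real.exp_log (by positivity)]
    rfl
  have hQ : ((q : ℝ) ^ k)⁻¹ = Real.exp (-(k * Real.log q)) := by
    rw [Real.exp_neg, Real.exp_nat_mul, Real.exp_log (by positivity)]
  have hd : 0 < 2 * (1 - ε) * k := by
    have : 0 < 1 - ε := by linarith
    positivity
  have hz : ((Finset.univ.filter fun d => h d = 0).card : ℝ) + (suppFinset h).card = k := by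
    exact_mod_cast card_zeros_add_card_suppFinset h
  unfold rowWeight
  rw [hP, hQ]
  set t : ℝ := ((suppFinset h).card : ℝ) with ht
  have ht0 : 0 ≤ t := by positivity
  rcases le_total t (ε * k) with hl | hl
  · refine le_add_of_le_of_nonneg (Real.exp_le_exp.2 (neg_le_neg ?_)) (Real.exp_pos _).le
    have hD : 2 * (t * (Finset.univ.filter fun d => h d = 0).card) ≤ (pairDiff h : ℝ) := by
      rw [ht]
      exact_mod_cast two_mul_card_suppFinset_mul_le h
    have hD' : 2 * (1 - ε) * k * t ≤ pairDiff h := by nlinarith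
    rw [div_mul_eq_mul_div, le_div_iff₀ hd]
    calc (Real.log k + Real.log q) * t * (2 * (1 - ε) * k)
        = (Real.log k + Real.log q) * (2 * (1 - ε) * k * t) := by ring
      _ ≤ (Real.log k + K * Real.log q) * pairDiff h := by
          gcongr
          nlinarith
  · refine le_add_of_nonneg_of_le (Real.exp_pos _).le (Real.exp_le_exp.2 (neg_le_neg ?_))
    have hD : k * t ≤ (pairDiff h : ℝ) := by
      rw [ht]
      exact_mod_cast hh.mul_card_suppFinset_le
    have hD' : ε * k * k ≤ pairDiff h := by nlinarith
    rw [div_mul_eq_mul_div, le_div_iff₀ hd]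
    calc k * Real.log q * (2 * (1 - ε) * k) ≤ k * Real.log q * (ε * K * k) := by
          have h2 : 2 * (1 - ε) ≤ ε * K := by linarith
          gcongr
      _ = (0 + K * Real.log q) * (ε * k * k) := by ring
      _ ≤ (Real.log k + K * Real.log q) * pairDiff h := by gcongr

theorem card_le_of_pairDiff_sum_le {k q : ℕ} [NeZero q] (hk : 0 < k) {ε K M : ℝ} (hε0 : 0 < ε)
    (hε1 : ε < 1) (hK : 2 ≤ ε * K) (A : Finset (Fin k → Fin k → ZMod q))
    (hA : ∀ g ∈ A, (∀ b, IsZeroMode (g b)) ∧ ((∑ b, pairDiff (g b) : ℕ) : ℝ) ≤ M * k) :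
    (A.card : ℝ) ≤
      Real.exp ((Real.log k + K * Real.log q) / (2 * (1 - ε)) * M) * 4 ^ k := by
  have hq : 0 < q := Nat.pos_of_ne_zero (NeZero.ne q)
  have hq' : (1 : ℝ) ≤ q := by exact_mod_cast hq
  have hk' : (1 : ℝ) ≤ k := by exact_mod_cast hk
  have hlk : 0 ≤ Real.log k := Real.log_nonneg hk'
  have hlq : 0 ≤ Real.log q := Real.log_nonneg hq'
  have hK1 : 1 ≤ K := by nlinarith
  have hε : 0 < 1 - ε := by linarith
  set c : ℝ := (Real.log k + K * Real.log q) / (2 * (1 - ε) * k) with hc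
  have hc0 : 0 ≤ c := by positivity
  have hcM : c * (M * k) = (Real.log k + K * Real.log q) / (2 * (1 - ε)) * M := by
    rw [hc]
    field_simp
  have hW0 : ∀ h : Fin k → ZMod q, 0 ≤ rowWeight h := fun h => by
    unfold rowWeight
    refine add_nonneg (Finset.prod_nonneg fun i _ => ?_) (by positivity)
    split_ifs <;> positivity
  rw [← hcM]
  calc (A.card : ℝ) = ∑ _g ∈ A, (1 : ℝ) := by simp
    _ ≤ ∑ g ∈ A, Real.exp (c * (M * k)) * ∏ b, rowWeight (g b) := by
        refine Finset.sum_le_sum fun g hg => ?_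
        obtain ⟨hg1, hg2⟩ := hA g hg
        calc (1 : ℝ) ≤ Real.exp (c * (M * k) + ∑ b, -(c * pairDiff (g b))) := by
              rw [Real.one_le_exp_iff, Finset.sum_neg_distrib, ← Finset.mul_sum, ← sub_eq_add_neg,
                ← mul_sub]
              push_cast at hg2
              exact mul_nonneg hc0 (by linarith)
          _ = Real.exp (c * (M * k)) * ∏ b, Real.exp (-(c * pairDiff (g b))) := by
              rw [Real.exp_add, Real.exp_sum]
          _ ≤ _ := by
              gcongr with b
              exact (hg1 b).exp_neg_le_rowWeight hk hq hε0 hε1 hK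
    _ ≤ ∑ g : Fin k → Fin k → ZMod q, Real.exp (c * (M * k)) * ∏ b, rowWeight (g b) :=
        Finset.sum_le_sum_of_subset_of_nonneg (Finset.subset_univ _) fun g _ _ =>
          mul_nonneg (Real.exp_pos _).le (Finset.prod_nonneg fun b _ => hW0 _)
    _ = Real.exp (c * (M * k)) * (∑ h : Fin k → ZMod q, rowWeight h) ^ k := by
        rw [← Finset.mul_sum, Fintype.sum_pow]
    _ ≤ _ := by
        gcongr
        · exact Finset.sum_nonneg fun h _ => hW0 h
        · exact sum_rowWeight_le hk

/-- The sum of the entries of `y` in the first `a` rows and `c` columns. -/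
def cornerSum {m q : ℕ} (y : Matrix (Fin m) (Fin m) (ZMod q)) (a c : ℕ) : ZMod q :=
  ∑ x ∈ Finset.univ.filter (fun x : Fin m => (x : ℕ) < a),
    ∑ z ∈ Finset.univ.filter (fun z : Fin m => (z : ℕ) < c), y x z

theorem sum_filter_interval_eq_sub {m : ℕ} {G : Type*} [AddCommGroup G] (u : Fin m → G) {i j : ℕ}
    (hij : i ≤ j) :
    ∑ a ∈ Finset.univ.filter (fun a : Fin m => i + 1 ≤ (a : ℕ) + 1 ∧ (a : ℕ) + 1 ≤ j), u a =
      ∑ a ∈ Finset.univ.filter (fun a : Fin m => (a : ℕ) < j), u a -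
        ∑ a ∈ Finset.univ.filter (fun a : Fin m => (a : ℕ) < i), u a := by
  rw [eq_sub_iff_add_eq, ← Finset.sum_union]
  · refine Finset.sum_congr ?_ fun _ _ => rfl
    ext a
    simp only [Finset.mem_union, Finset.mem_filter, Finset.mem_univ, true_and]
    omega
  · rw [Finset.disjoint_filter]
    intro a _ h1 h2
    omega

theorem bsum_eq_cornerSum {m q : ℕ} (y : Matrix (Fin m) (Fin m) (ZMod q)) {a b c d : ℕ}
    (hab : a ≤ b) (hcd : c ≤ d) :
    bsum y (a + 1) b (c + 1) d =
      cornerSum y b d - cornerSum y a d - (cornerSum y b c - cornerSum y a c) := by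
  simp only [bsum, cornerSum, sum_filter_interval_eq_sub _ hcd, Finset.sum_sub_distrib,
    sum_filter_interval_eq_sub _ hab]
  abel

theorem bsum_single {m q : ℕ} (y : Matrix (Fin m) (Fin m) (ZMod q)) (i j : Fin m) :
    bsum y (i + 1) (i + 1) (j + 1) (j + 1) = y i j := by
  have h : ∀ i : Fin m, Finset.univ.filter
      (fun a : Fin m => (i : ℕ) + 1 ≤ (a : ℕ) + 1 ∧ (a : ℕ) + 1 ≤ i + 1) = {i} := by
    intro i
    ext a
    simp only [Finset.mem_filter, Finset.mem_univ, true_and, Finset.mem_singleton, Fin.ext_iff]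
    omega
  rw [bsum, h, h, Finset.sum_singleton, Finset.sum_singleton]

theorem sum_pairDiff_le_four_mul_Nboxes {m q : ℕ} (y : Matrix (Fin m) (Fin m) (ZMod q)) :
    ∑ a : Fin (m + 1), ∑ b : Fin (m + 1),
      pairDiff (fun c : Fin (m + 1) => cornerSum y b c - cornerSum y a c) ≤ 4 * Nboxes y := by
  set Q : Finset (Fin (m + 1) × Fin (m + 1) × Fin (m + 1) × Fin (m + 1)) :=
    Finset.univ.filter fun p =>
      cornerSum y p.2.1 p.2.2.2 - cornerSum y p.1 p.2.2.2 ≠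
        cornerSum y p.2.1 p.2.2.1 - cornerSum y p.1 p.2.2.1 with hQ
  have h1 : ∑ a : Fin (m + 1), ∑ b : Fin (m + 1),
      pairDiff (fun c : Fin (m + 1) => cornerSum y b c - cornerSum y a c) = Q.card := by
    simp only [pairDiff, hQ, Finset.card_filter, Fintype.sum_prod_type]
  rw [h1]
  set B := ((Finset.Icc 1 m ×ˢ Finset.Icc 1 m) ×ˢ (Finset.Icc 1 m ×ˢ Finset.Icc 1 m)).filter
    (fun p => p.1.1 ≤ p.1.2 ∧ p.2.1 ≤ p.2.2 ∧ bsum y p.1.1 p.1.2 p.2.1 p.2.2 ≠ 0) with hB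
  have h2 : Q.card ≤ ((Finset.univ : Finset (Bool × Bool)) ×ˢ B).card := by
    refine Finset.card_le_card_of_injOn (fun p =>
      ((decide ((p.1 : ℕ) < p.2.1), decide ((p.2.2.1 : ℕ) < p.2.2.2)),
        ((min (p.1 : ℕ) p.2.1 + 1, max (p.1 : ℕ) p.2.1),
          (min (p.2.2.1 : ℕ) p.2.2.2 + 1, max (p.2.2.1 : ℕ) p.2.2.2)))) ?_ ?_
    · rintro ⟨a, b, c, d⟩ hp
      simp only [hQ, Finset.coe_filter, Finset.mem_univ, true_and, Set.mem_ofPred_eq] at hp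
      have hab : (a : ℕ) ≠ b := fun h => hp (by rw [h, sub_self, sub_self])
      have hcd : (c : ℕ) ≠ d := fun h => hp (by rw [h])
      have ha := a.2
      have hb := b.2
      have hc := c.2
      have hd := d.2
      simp only [hB, Finset.coe_product, Set.mem_prod, Finset.coe_univ, Set.mem_univ, true_and,
        Finset.mem_coe, Finset.mem_filter, Finset.mem_product, Finset.mem_Icc]
      refine ⟨by omega, by omega, by omega, ?_⟩
      rw [bsum_eq_cornerSum y min_le_max min_le_max]
      rcases le_total (a : ℕ) b with h | h <;> rcases le_total (c : ℕ) d with h' | h' <;>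
        simp only [max_eq_left, max_eq_right, min_eq_left, min_eq_right, h, h'] <;>
        intro h0 <;> apply hp <;> first | linear_combination h0 | linear_combination -h0
    · rintro ⟨a, b, c, d⟩ - ⟨a', b', c', d'⟩ - h
      simp only [Prod.mk.injEq, decide_eq_decide] at h
      simp only [Prod.mk.injEq, Fin.ext_iff]
      omega
  refine h2.trans (le_of_eq ?_)
  simp [Finset.card_product, Nboxes, hB]

theorem pairDiff_sub_const {k : ℕ} {G : Type*} [AddGroup G] [DecidableEq G] (h : Fin k → G)
    (v : G) : pairDiff (fun c => h c - v) = pairDiff h := by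
  simp [pairDiff]

theorem exists_isZeroMode_sub {k q : ℕ} [NeZero q] (h : Fin k → ZMod q) :
    ∃ v, IsZeroMode fun c => h c - v := by
  obtain ⟨v, -, hv⟩ := Finset.exists_max_image (Finset.univ : Finset (ZMod q))
    (fun v => (Finset.univ.filter fun d => h d = v).card) ⟨0, Finset.mem_univ _⟩
  refine ⟨v, fun x => ?_⟩
  simpa [sub_eq_iff_eq_add] using hv (x + v) (Finset.mem_univ _)

/-- Up to adding functions of the row and of the column, the corner sums of a matrix with few
nonzero boxes have sparse rows. -/
theorem exists_sparse_representative {m q : ℕ} [NeZero q]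
    (y : Matrix (Fin m) (Fin m) (ZMod q)) {M : ℝ}
    (hy : 4 * (Nboxes y : ℝ) ≤ M * ((m + 1 : ℕ) : ℝ) ^ 2) :
    ∃ g : Fin (m + 1) → Fin (m + 1) → ZMod q,
      (∀ i j : Fin m, y i j =
        g i.succ j.succ - g i.castSucc j.succ - (g i.succ j.castSucc - g i.castSucc j.castSucc)) ∧
      (∀ b, IsZeroMode (g b)) ∧
      ((∑ b, pairDiff (g b) : ℕ) : ℝ) ≤ M * ((m + 1 : ℕ) : ℝ) := by
  obtain ⟨a, ha⟩ : ∃ a : Fin (m + 1), ((∑ b : Fin (m + 1),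
      pairDiff (fun c : Fin (m + 1) => cornerSum y b c - cornerSum y a c) : ℕ) : ℝ) ≤
        M * ((m + 1 : ℕ) : ℝ) := by
    by_contra! hcon
    have h1 := Finset.sum_lt_sum_of_nonempty (s := (Finset.univ : Finset (Fin (m + 1))))
      ⟨0, Finset.mem_univ _⟩ fun a _ => hcon a
    have h2 : ((∑ a : Fin (m + 1), ∑ b : Fin (m + 1),
        pairDiff (fun c : Fin (m + 1) => cornerSum y b c - cornerSum y a c) : ℕ) : ℝ) ≤
          ((4 * Nboxes y : ℕ) : ℝ) := by
      exact_mod_cast sum_pairDiff_le_four_mul_Nboxes y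
    rw [← Nat.cast_sum, Finset.sum_const, Finset.card_univ, Fintype.card_fin, nsmul_eq_mul] at h1
    push_cast at h1 h2 hy
    linarith
  choose v hv using fun b : Fin (m + 1) => exists_isZeroMode_sub
    (fun c : Fin (m + 1) => cornerSum y b c - cornerSum y a c)
  refine ⟨fun b c => cornerSum y b c - cornerSum y a c - v b, fun i j => ?_, hv, ?_⟩
  · rw [← bsum_single y i j, bsum_eq_cornerSum y (Nat.le_succ _) (Nat.le_succ _)]
    simp only [Fin.val_succ, Fin.val_castSucc]
    ring
  · simpa only [pairDiff_sub_const] using ha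

theorem ncard_Nboxes_le {m q : ℕ} [NeZero q] {ε K M : ℝ} (hε0 : 0 < ε) (hε1 : ε < 1)
    (hK : 2 ≤ ε * K) :
    (Set.ncard {y : Matrix (Fin m) (Fin m) (ZMod q) |
        4 * (Nboxes y : ℝ) ≤ M * ((m + 1 : ℕ) : ℝ) ^ 2} : ℝ) ≤
      Real.exp ((Real.log ((m + 1 : ℕ) : ℝ) + K * Real.log q) / (2 * (1 - ε)) * M) *
        4 ^ (m + 1) := by
  classical
  set S := {y : Matrix (Fin m) (Fin m) (ZMod q) |
    4 * (Nboxes y : ℝ) ≤ M * ((m + 1 : ℕ) : ℝ) ^ 2} with hS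
  choose! g hg1 hg2 using fun (y : Matrix (Fin m) (Fin m) (ZMod q)) (hy : y ∈ S) =>
    exists_sparse_representative y hy
  have hinj : Set.InjOn g S := fun y hy y' hy' h => by
    ext i j
    rw [hg1 y hy, hg1 y' hy', h]
  rw [← hinj.ncard_image, Set.ncard_eq_toFinset_card']
  refine card_le_of_pairDiff_sum_le (Nat.succ_pos m) hε0 hε1 hK _ fun f hf => ?_
  obtain ⟨y, hy, rfl⟩ := Set.mem_toFinset.1 hf
  exact hg2 y hy

theorem stmt17 (n q : ℕ) (hn : 3 ≤ n) (hq : 2 ≤ q)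
    (ε : ℝ) (hε0 : 1 / Real.sqrt (Real.log n) ≤ ε) (hε1 : ε ≤ 1 / 80)
    (w : ℕ) (hw : ε * n ≤ (w : ℝ)) :
    (Set.ncard {y : Matrix (Fin (n - 1)) (Fin (n - 1)) (ZMod q) |
        (Nboxes y : ℝ) ≤ ((w : ℝ) + 1 / 2) * (n : ℝ) ^ 2} : ℝ)
      ≤ (n : ℝ) ^ (2 * (w : ℝ)
          + (200 * Real.log q / (ε * Real.sqrt (Real.log n)) + 80) * ε * w) := by
  obtain ⟨m, rfl⟩ : ∃ m, n = m + 1 := ⟨n - 1, by omega⟩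
  change (Set.ncard {y : Matrix (Fin m) (Fin m) (ZMod q) | _} : ℝ) ≤ _
  have : NeZero q := ⟨by omega⟩
  set N : ℝ := ((m + 1 : ℕ) : ℝ) with hN
  have hN3 : (3 : ℝ) ≤ N := by rw [hN]; exact_mod_cast hn
  set L : ℝ := Real.log N with hL
  have hL0 : 0 < L := Real.log_pos (by linarith)
  set s : ℝ := Real.sqrt L with hs
  have hs0 : 0 < s := Real.sqrt_pos.2 hL0
  have hss : s * s = L := Real.mul_self_sqrt hL0.le
  have hl0 : 0 ≤ Real.log q := Real.log_nonneg (by exact_mod_cast (by omega : 1 ≤ q))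
  have hε : 0 < ε := lt_of_lt_of_le (by positivity) hε0
  have hεs : 1 ≤ ε * s := by rwa [div_le_iff₀ hs0] at hε0
  have hLN : L ≤ N := by linarith [Real.log_le_sub_one_of_pos (by linarith : 0 < N)]
  have hNw : N ≤ s * w := by nlinarith
  have hNεw : N ≤ ε * w * L := by
    rw [← hss]
    nlinarith [mul_le_mul_of_nonneg_left hεs (mul_nonneg hs0.le (Nat.cast_nonneg (α := ℝ) w))]
  have hεw : 1 ≤ ε * w := by nlinarith
  have hw1 : (1 : ℝ) ≤ w := by nlinarith
  have hset : {y : Matrix (Fin m) (Fin m) (ZMod q) |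
      (Nboxes y : ℝ) ≤ ((w : ℝ) + 1 / 2) * N ^ 2} =
      {y | 4 * (Nboxes y : ℝ) ≤ (4 * w + 2) * N ^ 2} := by
    ext y
    simp only [Set.mem_ofPred_eq]
    constructor <;> intro h <;> linarith
  rw [hset]
  refine (ncard_Nboxes_le (K := 2 * s) hε (by linarith) (by linarith)).trans ?_
  have h4 : (4 : ℝ) ^ (m + 1) ≤ Real.exp (2 * N) := by
    have : (4 : ℝ) ≤ Real.exp 2 := by
      rw [show (2 : ℝ) = 1 + 1 by norm_num, Real.exp_add]
      nlinarith [Real.add_one_le_exp (1 : ℝ)]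
    calc (4 : ℝ) ^ (m + 1) ≤ Real.exp 2 ^ (m + 1) := by gcongr
      _ = Real.exp (2 * N) := by rw [← Real.exp_nat_mul, mul_comm]
  rw [Real.rpow_def_of_pos (by linarith : 0 < N)]
  refine (mul_le_mul_of_nonneg_left h4 (Real.exp_pos _).le).trans ?_
  rw [← Real.exp_add, Real.exp_le_exp, ← hN, ← hL]
  have hX : (L + 2 * s * Real.log q) / (2 * (1 - ε)) * (4 * w + 2) ≤
      (L + 2 * s * Real.log q) * ((1 + 2 * ε) * (2 * w + 1)) := by
    rw [div_mul_eq_mul_div, div_le_iff₀ (by linarith)]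
    have h1 : 1 ≤ (1 + 2 * ε) * (1 - ε) := by nlinarith
    have h2 : 0 ≤ (L + 2 * s * Real.log q) * (4 * w + 2) := by positivity
    nlinarith [mul_le_mul_of_nonneg_left h1 h2]
  have hRHS : L * (2 * (w : ℝ) + (200 * Real.log q / (ε * s) + 80) * ε * w) =
      L * (2 * w + 80 * (ε * w)) + 200 * (s * Real.log q * w) := by
    rw [← hss]
    field_simp
    ring
  rw [hRHS]
  have hA : L * ((1 + 2 * ε) * (2 * w + 1)) ≤ L * (2 * w + 10 * (ε * w)) := by
    refine mul_le_mul_of_nonneg_left ?_ hL0.le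
    nlinarith
  have hB : s * Real.log q * ((1 + 2 * ε) * (2 * w + 1)) ≤ s * Real.log q * (6 * w) := by
    refine mul_le_mul_of_nonneg_left ?_ (by positivity)
    nlinarith
  have hC : 0 ≤ s * Real.log q * w := by positivity
  nlinarith
end
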